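/- arXiv:1301.2986 — 2 statements merged into one kernel-verified Lean document; each statement's English description precedes it below -/
import Mathlib

section
/- For any prime p ≥ 5 and nonnegative integers k, s, the Gaussian binomial coefficient C(kp, sp)_q, viewed as a polynomial in q with integer coefficients, satisfies C(kp, sp)_q ≡ C(k, s)_{q^{p^2}} − C(k, s+1)·C(s+1, 2)·((p^2−1)/12)·(q^p − 1)^2 modulo [p]_q^3 in ℤ[q]. -/
open Polynomial Finset

noncomputable def qInt (n : ℕ) : Polynomial ℤ := ∑ i ∈ Finset.range n, X ^ i

noncomputable def qBinom : ℕ → ℕ → Polynomial ℤ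
  | _, 0 => 1
  | 0, _ + 1 => 0
  | n + 1, k + 1 => qBinom n k + X ^ (k + 1) * qBinom n (k + 1)

theorem choose_two_of_odd {p h : ℕ} (hp : p = 2 * h + 1) : p.choose 2 = p * h := by
  rw [Nat.choose_two_right, hp, Nat.add_sub_cancel,
    show (2 * h + 1) * (2 * h) = 2 * ((2 * h + 1) * h) by ring,
    Nat.mul_div_cancel_left _ two_pos]

theorem choose_three_of_odd {p h c : ℕ} (hp : p = 2 * h + 1) (hc : 6 * c = h * (h + 1)) :
    p.choose 3 = p * h.choose 2 + p * c := by
  have h3 := Nat.choose_succ_right_eq p 2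
  have h2 := Nat.choose_succ_right_eq h 1
  rw [choose_two_of_odd hp] at h3
  rw [Nat.choose_one_right] at h2
  rcases h with _ | h
  · simp_all
  rw [show p - 2 = 2 * h + 1 by omega] at h3
  simp only [Nat.add_sub_cancel, Nat.reduceAdd] at h2 h3
  zify at *
  refine mul_left_cancel₀ (show (6 : ℤ) ≠ 0 by norm_num) ?_
  linear_combination 2 * h3 - 3 * p * h2 - p * hc

section NilpotentExpansion

variable {S : Type*} [CommRing S]

theorem one_add_pow_of_cube_eq_zero {x : S} (hx : x ^ 3 = 0) (n : ℕ) :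
    (1 + x) ^ n = 1 + n * x + n.choose 2 * x ^ 2 := by
  induction n with
  | zero => simp
  | succ n ih =>
    rw [pow_succ, ih, Nat.choose_succ_succ' n 1, Nat.choose_one_right]
    push_cast
    linear_combination (n.choose 2 : S) * hx

theorem geom_sum_one_add_of_cube_eq_zero {x : S} (hx : x ^ 3 = 0) (n : ℕ) :
    ∑ i ∈ range n, (1 + x) ^ i = n + n.choose 2 * x + n.choose 3 * x ^ 2 := by
  induction n with
  | zero => simp
  | succ n ih =>
    rw [sum_range_succ, ih, one_add_pow_of_cube_eq_zero hx, Nat.choose_succ_succ' n 1,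
      Nat.choose_succ_succ' n 2, Nat.choose_one_right]
    push_cast
    ring

theorem mul_one_add_pow_of_mul_sq_eq_zero {d x : S} (hd : d * x ^ 2 = 0) (n : ℕ) :
    d * (1 + x) ^ n = d * (1 + n * x) := by
  induction n with
  | zero => simp
  | succ n ih =>
    rw [pow_succ, ← mul_assoc, ih]
    push_cast
    linear_combination (n : S) * hd

theorem mul_geom_sum_one_add_pow_of_mul_sq_eq_zero {d x : S} (hd : d * x ^ 2 = 0) (m n : ℕ) :
    d * ∑ i ∈ range n, ((1 + x) ^ m) ^ i = d * (n + m * n.choose 2 * x) := by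
  induction n with
  | zero => simp
  | succ n ih =>
    rw [sum_range_succ, mul_add, ih, ← pow_mul, mul_one_add_pow_of_mul_sq_eq_zero hd,
      Nat.choose_succ_succ' n 1, Nat.choose_one_right]
    push_cast
    ring

theorem prod_pow_sub_pow_eq_pow_mul_prod (q : S) (h m : ℕ) :
    ∏ j ∈ range (2 * h), ((q ^ (2 * h + 1)) ^ (m + 1) - q ^ (j + 1)) =
      (q ^ (2 * h + 1)) ^ h * ∏ j ∈ range (2 * h), (1 - q ^ (m * (2 * h + 1) + (j + 1))) := by
  have hexp : ∑ j ∈ range (2 * h), (2 * h - j) = (2 * h + 1) * h := by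
    have h1 := sum_range_reflect (fun i => i + 1) (2 * h)
    have h2 : ∑ j ∈ range (2 * h), (2 * h - j) =
        ∑ j ∈ range (2 * h), (2 * h - 1 - j + 1) :=
      sum_congr rfl fun j hj => by have := mem_range.1 hj; omega
    have h3 := sum_range_id_mul_two (2 * h + 1)
    rw [sum_range_succ'] at h3
    rw [h2, h1]
    simp only [add_zero, Nat.add_sub_cancel] at h3
    linarith
  have hpow : (q ^ (2 * h + 1)) ^ h = ∏ j ∈ range (2 * h), (-1) * q ^ (2 * h - j) := by
    rw [← pow_mul, ← hexp, prod_mul_distrib, prod_pow_eq_pow_sum]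
    simp
  rw [hpow, ← prod_range_reflect, ← prod_mul_distrib]
  refine prod_congr rfl fun j hj => ?_
  have hj' := mem_range.1 hj
  have e1 : (q ^ (2 * h + 1)) ^ (m + 1) = q ^ (2 * h - j) * q ^ (m * (2 * h + 1) + (j + 1)) := by
    rw [← pow_mul, ← pow_add]
    congr 1
    have : 2 * h - j + j = 2 * h := by omega
    linarith
  rw [e1, show 2 * h - 1 - j + 1 = 2 * h - j by omega]
  ring

/-- The product `∏ (Q ^ m - q ^ j)` over `0 < j < p`, where `Q = q ^ p = 1 + x`, is up to the
constant `∏ (1 - q ^ j) / p` equal to `[p]` at `Q ^ m`, with an explicit error term that is linear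
in `m`. -/
theorem natCast_mul_prod_pow_sub_eq {q x φ w : S} {p h c : ℕ} (hp : p = 2 * h + 1)
    (hc : 6 * c = h * (h + 1)) (hφ : φ ^ 3 = 0) (hq : q ^ p = 1 + x) (hx : x = φ * w)
    {W : S[X]} (hW : ∏ j ∈ range (2 * h), (X - C (q ^ (j + 1))) =
      ∑ i ∈ range p, X ^ i + C φ * W) (m : ℕ) :
    p * ∏ j ∈ range (2 * h), ((1 + x) ^ m - q ^ (j + 1)) =
      (∏ j ∈ range (2 * h), (1 - q ^ (j + 1))) * (∑ i ∈ range p, ((1 + x) ^ m) ^ i) *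
        (1 - m * c * x ^ 2) := by
  have hx3 : x ^ 3 = 0 := by rw [hx]; linear_combination w ^ 3 * hφ
  have hT (z : S) : ∏ j ∈ range (2 * h), (z - q ^ (j + 1)) =
      ∑ i ∈ range p, z ^ i + φ * W.eval z := by
    have := congrArg (Polynomial.eval z) hW
    simpa [eval_prod, eval_finsetSum] using this
  have hWe (m : ℕ) : φ * W.eval ((1 + x) ^ m) =
      φ * W.eval 1 + m * (φ * (derivative W).eval 1 * x) := by
    obtain ⟨r, hr⟩ := W.binomExpansion 1 (m * x + m.choose 2 * x ^ 2)
    rw [one_add_pow_of_cube_eq_zero hx3, add_assoc, hr, hx]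
    linear_combination ((derivative W).eval 1 * m.choose 2 * w ^ 2 +
      r * w ^ 2 * (m + m.choose 2 * φ * w) ^ 2) * hφ
  have hd : φ * W.eval 1 * x ^ 2 = 0 := by
    rw [hx]; linear_combination W.eval 1 * w ^ 2 * hφ
  generalize hd' : φ * W.eval 1 = d at *
  generalize φ * (derivative W).eval 1 * x = e at *
  have hA : ∏ j ∈ range (2 * h), (1 - q ^ (j + 1)) = p + d := by
    rw [hT, hd']; simp
  have hchoose : ((p * h.choose 2 + p * c : ℕ) : S) = (p.choose 3 : ℕ) := by
    rw [choose_three_of_odd hp hc]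
  have hchoose2 : ((p.choose 2 : ℕ) : S) = (p * h : ℕ) := by
    rw [choose_two_of_odd hp]
  have hsym := prod_pow_sub_pow_eq_pow_mul_prod q h 0
  simp only [zero_mul, zero_add, pow_one] at hsym
  rw [← hp, hq, hA, hT, ← pow_one (1 + x), hWe 1, pow_one, geom_sum_one_add_of_cube_eq_zero hx3,
    one_add_pow_of_cube_eq_zero hx3] at hsym
  have hH := mul_geom_sum_one_add_pow_of_mul_sq_eq_zero hd m p
  have hH2 := mul_geom_sum_one_add_pow_of_mul_sq_eq_zero (d := x ^ 2) (x := x)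
    (by linear_combination x * hx3) m p
  rw [hT, hWe, hA]
  generalize ∑ i ∈ range p, ((1 + x) ^ m) ^ i = H at *
  push_cast at hsym hchoose hchoose2
  rw [hchoose2] at hsym hH hH2
  linear_combination p * m * hsym - hH + m * c * p * hH2 + m * c * p * m * p * h * hx3 +
    m * c * H * hd + p * m * h.choose 2 * hd + p * m * x ^ 2 * hchoose

end NilpotentExpansion

theorem C_qInt_dvd_prod_sub_geom_sum {p : ℕ} (hp : p.Prime) :
    C (qInt p) ∣ ∏ j ∈ range (p - 1), ((X : ℤ[X][X]) - C (X ^ (j + 1))) - ∑ i ∈ range p, X ^ i := by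
  have := Fact.mk hp
  have hζ := Complex.isPrimitiveRoot_exp p hp.ne_zero
  set ζ := Complex.exp (2 * Real.pi * Complex.I / p)
  have hprod : ∏ j ∈ range (p - 1), ((X : ℂ[X]) - C (ζ ^ (j + 1))) = ∑ i ∈ range p, X ^ i := by
    have h := X_pow_sub_C_eq_prod hζ hp.pos (one_pow p)
    obtain ⟨n, rfl⟩ := Nat.exists_eq_succ_of_ne_zero hp.ne_zero
    rw [C_1, ← mul_geom_sum, prod_range_succ', pow_zero, mul_one, mul_comm, C_1] at h
    simpa using (mul_right_cancel₀ (X_sub_C_ne_zero (1 : ℂ)) (by simpa using h)).symm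
  rw [C_dvd_iff_dvd_coeff]
  intro i
  rw [qInt, ← cyclotomic_prime ℤ p, cyclotomic_eq_minpoly hζ hp.pos]
  refine minpoly.isIntegrallyClosed_dvd (hζ.isIntegral hp.pos) ?_
  have := congrArg (fun f => coeff f i) (sub_eq_zero.2 hprod)
  rw [coeff_zero] at this
  rw [← this]
  change (aeval ζ : ℤ[X] →ₐ[ℤ] ℂ).toRingHom _ = _
  rw [← coeff_map]
  simp [Polynomial.map_prod, Polynomial.map_sum]

/-- The `q`-Pochhammer symbol `(1 - q) (1 - q ^ 2) ⋯ (1 - q ^ n)`. -/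
noncomputable def qPoch (n : ℕ) : ℤ[X] := ∏ i ∈ range n, (1 - X ^ (i + 1))

theorem qPoch_succ (n : ℕ) : qPoch (n + 1) = qPoch n * (1 - X ^ (n + 1)) :=
  prod_range_succ _ _

theorem one_sub_X_pow_ne_zero {n : ℕ} (hn : n ≠ 0) : (1 - X ^ n : ℤ[X]) ≠ 0 := by
  intro h
  have := congrArg (Polynomial.eval 2) h
  simp only [eval_sub, eval_one, eval_pow, eval_X, eval_zero] at this
  have h2 : (1 : ℤ) < 2 ^ n := one_lt_pow₀ (by norm_num) hn
  omega

theorem qPoch_comp_ne_zero (n : ℕ) {a : ℕ} (ha : a ≠ 0) : (qPoch n).comp (X ^ a) ≠ 0 := by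
  rw [qPoch, Polynomial.prod_comp, prod_ne_zero_iff]
  intro i _
  simpa [← pow_mul] using one_sub_X_pow_ne_zero (mul_ne_zero ha i.succ_ne_zero)

theorem qBinom_eq_zero_of_lt {n k : ℕ} (h : n < k) : qBinom n k = 0 := by
  induction n generalizing k with
  | zero => obtain ⟨k, rfl⟩ := Nat.exists_eq_succ_of_ne_zero h.ne'; simp [qBinom]
  | succ n ih =>
    obtain ⟨k, rfl⟩ := Nat.exists_eq_succ_of_ne_zero (Nat.ne_zero_of_lt h)
    rw [Nat.succ_eq_add_one, qBinom, ih (by omega), ih (by omega)]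
    simp

theorem qBinom_zero_right (n : ℕ) : qBinom n 0 = 1 := by cases n <;> simp [qBinom]

theorem qBinom_mul_qPoch_mul_qPoch (n k : ℕ) :
    qBinom (n + k) k * qPoch k * qPoch n = qPoch (n + k) := by
  induction hN : n + k generalizing n k with
  | zero =>
    obtain ⟨rfl, rfl⟩ : n = 0 ∧ k = 0 := by omega
    simp [qBinom, qPoch]
  | succ N ih =>
    rcases k with _ | k
    · subst hN; simp [qBinom_zero_right, qPoch]
    rw [qBinom, add_mul, add_mul, qPoch_succ N]
    have h1 := ih n k (by omega)
    rcases n with _ | n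
    · rw [qBinom_eq_zero_of_lt (show N < k + 1 by omega), qPoch_succ k]
      rw [show N = k by omega] at h1 ⊢
      linear_combination (1 - X ^ (k + 1)) * h1
    · have h2 := ih n (k + 1) (by omega)
      rw [qPoch_succ k] at h2 ⊢
      rw [qPoch_succ n] at h1 ⊢
      rw [show N + 1 = (k + 1) + (n + 1) by omega, pow_add]
      linear_combination (1 - X ^ (k + 1)) * h1 + X ^ (k + 1) * (1 - X ^ (n + 1)) * h2

theorem eval_one_qBinom (n k : ℕ) : (qBinom n k).eval 1 = n.choose k := by
  induction n generalizing k with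
  | zero => cases k <;> simp [qBinom]
  | succ n ih => cases k <;> simp [qBinom, ih, Nat.choose_succ_succ']

theorem qPoch_mul_eq (k r : ℕ) :
    qPoch (k * (r + 1)) = (qPoch k).comp (X ^ (r + 1)) *
      ∏ m ∈ range k, ∏ j ∈ range r, (1 - X ^ (m * (r + 1) + (j + 1))) := by
  induction k with
  | zero => simp [qPoch]
  | succ k ih =>
    rw [prod_range_succ, qPoch_succ, mul_comp, add_one_mul, qPoch, prod_range_add, ← qPoch, ih,
      prod_range_succ]
    simp only [sub_comp, one_comp, pow_comp, X_comp, ← pow_mul, add_assoc]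
    rw [show (r + 1) * (k + 1) = k * (r + 1) + (r + 1) by ring]
    ring

theorem qPoch_comp_X_pow_sq (k p : ℕ) :
    (qPoch k).comp (X ^ (p ^ 2)) = (qPoch k).comp (X ^ p) *
      ∏ m ∈ range k, ∑ i ∈ range p, ((X ^ p) ^ (m + 1)) ^ i := by
  simp only [qPoch, Polynomial.prod_comp, ← prod_mul_distrib, sub_comp, one_comp, pow_comp, X_comp]
  refine prod_congr rfl fun m _ => ?_
  rw [mul_neg_geom_sum]
  ring

theorem qBinom_mul_mul_prod (n k r : ℕ) :
    qBinom ((n + k) * (r + 1)) (k * (r + 1)) *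
        (∏ m ∈ range k, ∏ j ∈ range r, (1 - X ^ (m * (r + 1) + (j + 1)))) *
        (∏ m ∈ range n, ∏ j ∈ range r, (1 - X ^ (m * (r + 1) + (j + 1)))) =
      (qBinom (n + k) k).comp (X ^ (r + 1)) *
        ∏ m ∈ range (n + k), ∏ j ∈ range r, (1 - X ^ (m * (r + 1) + (j + 1))) := by
  have h1 := qBinom_mul_qPoch_mul_qPoch (n * (r + 1)) (k * (r + 1))
  have h2 := congrArg (fun f => f.comp (X ^ (r + 1))) (qBinom_mul_qPoch_mul_qPoch n k)
  simp only [mul_comp] at h2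
  rw [← add_mul, qPoch_mul_eq, qPoch_mul_eq, qPoch_mul_eq, ← h2] at h1
  refine mul_right_cancel₀ (mul_ne_zero (qPoch_comp_ne_zero k r.succ_ne_zero)
    (qPoch_comp_ne_zero n r.succ_ne_zero)) ?_
  linear_combination h1

theorem qBinom_comp_X_pow_sq_mul_prod (n k : ℕ) {p : ℕ} (hp : p ≠ 0) :
    (qBinom (n + k) k).comp (X ^ (p ^ 2)) *
        (∏ m ∈ range k, ∑ i ∈ range p, ((X ^ p) ^ (m + 1)) ^ i) *
        (∏ m ∈ range n, ∑ i ∈ range p, ((X ^ p) ^ (m + 1)) ^ i) =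
      (qBinom (n + k) k).comp (X ^ p) *
        ∏ m ∈ range (n + k), ∑ i ∈ range p, (((X : ℤ[X]) ^ p) ^ (m + 1)) ^ i := by
  have h1 := congrArg (fun f => f.comp (X ^ (p ^ 2))) (qBinom_mul_qPoch_mul_qPoch n k)
  have h2 := congrArg (fun f => f.comp (X ^ p)) (qBinom_mul_qPoch_mul_qPoch n k)
  simp only [mul_comp] at h1 h2
  rw [qPoch_comp_X_pow_sq, qPoch_comp_X_pow_sq, qPoch_comp_X_pow_sq, ← h2] at h1
  refine mul_right_cancel₀ (mul_ne_zero (qPoch_comp_ne_zero k hp) (qPoch_comp_ne_zero n hp)) ?_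
  linear_combination h1

theorem prod_one_sub_linear {S : Type*} [CommRing S] {y : S} (hy : y ^ 2 = 0) (n : ℕ) :
    ∏ m ∈ range n, (1 - ((m + 1 : ℕ) : S) * y) = 1 - (n + 1).choose 2 * y := by
  induction n with
  | zero => simp
  | succ n ih =>
    rw [prod_range_succ, ih, Nat.choose_succ_succ' (n + 1) 1, Nat.choose_one_right]
    push_cast
    linear_combination ((n + 1).choose 2 * (n + 1) : S) * hy

theorem eq_mul_one_sub_of_mul_prod_eq {S : Type*} [CommRing S] {y v g r t : S} {F H : ℕ → S}
    (hy : y ^ 2 = 0) (hv : IsUnit v) (hH : ∀ m, IsUnit (H m))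
    (hF : ∀ m : ℕ, F m = v * (H m * (1 - ((m + 1 : ℕ) : S) * y))) {n k : ℕ}
    (hg : g * (∏ m ∈ range k, F m) * ∏ m ∈ range n, F m = t * ∏ m ∈ range (n + k), F m)
    (hr : r * (∏ m ∈ range k, H m) * ∏ m ∈ range n, H m = t * ∏ m ∈ range (n + k), H m) :
    g = r * (1 - n * k * y) := by
  have hprod (n : ℕ) : ∏ m ∈ range n, F m =
      v ^ n * ((∏ m ∈ range n, H m) * (1 - (n + 1).choose 2 * y)) := by
    simp only [hF, prod_mul_distrib, prod_const, card_range, prod_one_sub_linear hy]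
  have hu (n : ℕ) : IsUnit (∏ m ∈ range n, H m) := by
    simpa [IsUnit.prod_iff] using fun m _ => hH m
  have hchoose : (n + k + 1).choose 2 = (n + 1).choose 2 + (k + 1).choose 2 + n * k := by
    clear hg hr
    induction k with
    | zero => simp
    | succ k ih =>
      rw [← add_assoc, Nat.choose_succ_succ' (n + k + 1) 1, ih, Nat.choose_succ_succ' (k + 1) 1,
        Nat.choose_one_right, Nat.choose_one_right]
      ring
  simp only [hprod] at hg
  refine ((hv.pow (n + k)).mul ((hu k).mul (hu n))).mul_left_cancel ?_
  rw [hchoose] at hg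
  push_cast at hg
  generalize ((n + 1).choose 2 : S) = a at *
  generalize ((k + 1).choose 2 : S) = b at *
  generalize ∏ m ∈ range k, H m = P at *
  generalize ∏ m ∈ range n, H m = R at *
  generalize ∏ m ∈ range (n + k), H m = T at *
  linear_combination (1 + (a + b) * y) * hg - v ^ (n + k) * (1 - n * k * y) * hr +
    (v ^ (n + k) * (P * R) * g * ((a + b) ^ 2 - a * b - a * b * (a + b) * y) -
      v ^ (n + k) * t * T * (a + b) * (a + b + n * k)) * hy

theorem isUnit_geom_sum_one_add_pow {S : Type*} [CommRing S] {x : S} (hx : x ^ 3 = 0) {p : ℕ}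
    (hp : IsUnit (p : S)) (m : ℕ) : IsUnit (∑ i ∈ range p, ((1 + x) ^ m) ^ i) := by
  obtain ⟨z, hz⟩ : ∃ z, (1 + x) ^ m = 1 + x * z :=
    ⟨m + m.choose 2 * x, by rw [one_add_pow_of_cube_eq_zero hx]; ring⟩
  rw [hz, geom_sum_one_add_of_cube_eq_zero (by rw [mul_pow, hx, zero_mul]), add_assoc]
  refine IsNilpotent.isUnit_add_left_of_commute ⟨3, ?_⟩ hp (Commute.all _ _)
  linear_combination z ^ 3 * (p.choose 2 + p.choose 3 * (x * z)) ^ 3 * hx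

theorem choose_mul_choose_two_mul_div {p h c : ℕ} (hp : p = 2 * h + 1)
    (hc : 6 * c = h * (h + 1)) (n s : ℕ) :
    ((n + s).choose (s + 1) : ℤ) * ((s + 1).choose 2 : ℤ) * (((p : ℤ) ^ 2 - 1) / 12) =
      n * s * c * (n + s).choose s := by
  have h1 := Nat.choose_succ_right_eq (n + s) s
  have h2 := Nat.choose_succ_right_eq (s + 1) 1
  rw [Nat.choose_one_right] at h2
  simp only [Nat.add_sub_cancel, Nat.reduceAdd] at h1 h2
  have h3 : ((p : ℤ) ^ 2 - 1) / 12 = 2 * c := by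
    refine Int.ediv_eq_of_eq_mul_right (by norm_num) ?_
    zify at hc
    rw [hp]
    push_cast
    linear_combination -4 * hc
  rw [h3]
  zify at h1 h2
  linear_combination (n + s).choose (s + 1) * c * h2 + s * c * h1

theorem exists_half_and_sixth {p : ℕ} (hp : p.Prime) (hp5 : 5 ≤ p) :
    ∃ h c : ℕ, p = 2 * h + 1 ∧ 6 * c = h * (h + 1) := by
  obtain ⟨h, rfl⟩ := hp.odd_of_ne_two (by omega)
  have h2 : 2 ∣ h * (h + 1) := (Nat.even_mul_succ_self h).two_dvd
  have h3 : 3 ∣ h * (h + 1) := by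
    have : ¬ 3 ∣ 2 * h + 1 := fun hd => by
      have := (Nat.prime_dvd_prime_iff_eq Nat.prime_three hp).1 hd
      omega
    rcases (by omega : h % 3 = 0 ∨ h % 3 = 2) with h0 | h0
    · exact (Nat.dvd_of_mod_eq_zero h0).mul_right _
    · exact Dvd.dvd.mul_left (by omega) _
  obtain ⟨c, hc⟩ := Nat.Coprime.mul_dvd_of_dvd_of_dvd (by norm_num : Nat.Coprime 2 3) h2 h3
  exact ⟨h, c, rfl, hc.symm⟩

/-- The `q`-Ljunggren congruence holds under every ring homomorphism that kills `[p] ^ 3` and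
inverts `p`. -/
theorem map_qBinom_mul_mul_eq {S : Type*} [CommRing S] (ψ : ℤ[X] →+* S) {p h c : ℕ}
    (hp : p.Prime) (hph : p = 2 * h + 1) (hc : 6 * c = h * (h + 1))
    (hψ : ψ (qInt p) ^ 3 = 0) (hu : IsUnit (p : S)) (n s : ℕ) :
    ψ (qBinom ((n + s) * p) (s * p)) =
      ψ ((qBinom (n + s) s).comp (X ^ (p ^ 2))) -
        n * s * c * (n + s).choose s * (ψ X ^ p - 1) ^ 2 := by
  obtain ⟨x, hx⟩ : ∃ x, ψ X ^ p = 1 + x := ⟨ψ X ^ p - 1, by ring⟩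
  have hxφ : x = ψ (qInt p) * (ψ X - 1) := by
    rw [qInt, map_sum]
    simp only [map_pow]
    rw [geom_sum_mul, hx]
    ring
  have hx3 : x ^ 3 = 0 := by rw [hxφ, mul_pow, hψ, zero_mul]
  obtain ⟨W, hW⟩ := C_qInt_dvd_prod_sub_geom_sum hp
  have hW' : ∏ j ∈ range (2 * h), (X - C (ψ X ^ (j + 1))) =
      ∑ i ∈ range p, X ^ i + C (ψ (qInt p)) * W.map ψ := by
    have := congrArg (Polynomial.map ψ) (sub_eq_iff_eq_add'.1 hW)
    simpa [Polynomial.map_prod, Polynomial.map_sum, hph] using this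
  have hA : IsUnit (∏ j ∈ range (2 * h), (1 - ψ X ^ (j + 1))) := by
    have := congrArg (Polynomial.eval 1) hW'
    simp only [eval_prod, eval_sub, eval_X, eval_C, eval_add, eval_finsetSum, eval_pow, one_pow,
      sum_const, card_range, nsmul_eq_mul, mul_one, eval_mul] at this
    rw [this]
    exact IsNilpotent.isUnit_add_left_of_commute ⟨3, by rw [mul_pow, hψ, zero_mul]⟩ hu
      (Commute.all _ _)
  have hQ : IsUnit (1 + x) :=
    IsNilpotent.isUnit_add_left_of_commute ⟨3, hx3⟩ isUnit_one (Commute.all _ _)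
  obtain ⟨u, hu'⟩ := hu.mul (hQ.pow h)
  have hg := congrArg ψ (qBinom_mul_mul_prod n s (2 * h))
  have hr := congrArg ψ (qBinom_comp_X_pow_sq_mul_prod n s hp.ne_zero)
  rw [← hph] at hg
  simp only [map_mul, map_prod, map_sub, map_one, map_pow, map_sum, hx] at hg hr
  have key := eq_mul_one_sub_of_mul_prod_eq (y := c * x ^ 2)
    (v := ↑u⁻¹ * ∏ j ∈ range (2 * h), (1 - ψ X ^ (j + 1)))
    (by linear_combination (c : S) ^ 2 * x * hx3) (u⁻¹.isUnit.mul hA)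
    (fun m => isUnit_geom_sum_one_add_pow hx3 hu (m + 1)) (fun m => by
      have h1 := natCast_mul_prod_pow_sub_eq hph hc hψ hx hxφ hW' (m + 1)
      have h2 := prod_pow_sub_pow_eq_pow_mul_prod (ψ X) h m
      rw [← hph, hx] at h2
      rw [h2, ← mul_assoc, ← hu'] at h1
      rw [mul_assoc, Units.eq_inv_mul_iff_mul_eq, h1]
      ring) hg hr
  obtain ⟨z, hz⟩ : ∃ z, ψ ((qBinom (n + s) s).comp (X ^ (p ^ 2))) =
      (n + s).choose s + x * z := by
    have h1 : (X ^ p - 1 : ℤ[X]) ∣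
        (qBinom (n + s) s).comp (X ^ (p ^ 2)) - ((n + s).choose s : ℤ[X]) := by
      have h2 := sub_dvd_eval_sub (X ^ (p ^ 2)) 1 ((qBinom (n + s) s).map (C : ℤ →+* ℤ[X]))
      have h3 : ((qBinom (n + s) s).map (C : ℤ →+* ℤ[X])).eval 1 = (n + s).choose s := by
        rw [← C_1, eval_map, eval₂_at_apply, eval_one_qBinom]
        simp
      rw [h3, eval_map, ← comp] at h2
      refine dvd_trans ?_ h2
      rw [pow_two, pow_mul]
      simpa using sub_dvd_pow_sub_pow (X ^ p : ℤ[X]) 1 p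
    obtain ⟨z, hz⟩ := h1
    refine ⟨ψ z, ?_⟩
    have := congrArg ψ hz
    simp only [map_sub, map_mul, map_pow, map_natCast, map_one, hx] at this
    linear_combination this
  rw [key, hx, hz]
  linear_combination (-n * s * c * z : S) * hx3

theorem straub_q_ljunggren (p : ℕ) (hp : p.Prime) (hp5 : 5 ≤ p) (k s : ℕ) :
    (qInt p) ^ 3 ∣
      qBinom (k * p) (s * p) -
        ((qBinom k s).comp (X ^ (p ^ 2)) -
          C ((k.choose (s + 1) : ℤ) * ((s + 1).choose 2 : ℤ) * (((p : ℤ) ^ 2 - 1) / 12)) *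
            (X ^ p - 1) ^ 2) := by
  rcases lt_or_ge k s with hks | hks
  · rw [qBinom_eq_zero_of_lt hks, qBinom_eq_zero_of_lt (Nat.mul_lt_mul_of_pos_right hks hp.pos),
      Nat.choose_eq_zero_of_lt (by omega)]
    simp
  obtain ⟨n, rfl⟩ := Nat.exists_eq_add_of_le' hks
  obtain ⟨h, c, hph, hc⟩ := exists_half_and_sixth hp hp5
  rw [choose_mul_choose_two_mul_div hph hc]
  have := Fact.mk hp
  have hmonic : (qInt p ^ 3).Monic := by
    rw [qInt, ← cyclotomic_prime]
    exact (cyclotomic.monic p ℤ).pow 3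
  rw [← map_dvd_map (Int.castRingHom ℚ) Int.cast_injective hmonic, ← Ideal.mem_span_singleton,
    ← Ideal.Quotient.eq_zero_iff_mem]
  set I := Ideal.span {(qInt p ^ 3).map (Int.castRingHom ℚ)}
  let ψ : ℤ[X] →+* ℚ[X] ⧸ I := (Ideal.Quotient.mk I).comp (mapRingHom (Int.castRingHom ℚ))
  change ψ _ = 0
  have hψ : ψ (qInt p) ^ 3 = 0 := by
    rw [← map_pow]
    exact Ideal.Quotient.eq_zero_iff_mem.2 (Ideal.mem_span_singleton_self _)
  have hu : IsUnit (p : ℚ[X] ⧸ I) := by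
    have := (IsUnit.mk0 (p : ℚ) (Nat.cast_ne_zero.2 hp.ne_zero)).map
      ((Ideal.Quotient.mk I).comp C)
    simpa using this
  rw [map_sub, map_qBinom_mul_mul_eq ψ hp hph hc hψ hu n s]
  simp only [map_sub, map_mul, map_pow, map_one, map_natCast]
  ring
end

section
/- For any odd prime p and integer m ≥ 1, the polynomial ((q^{mp+1}; q)_{p−1} − q^{mp(p−1)/2}·(q; q)_{p−1}) is divisible by (1 − q^{(m+1)p})(1 − q^{mp}) modulo appropriate factors, and the quotient ((q^{mp+1}; q)_{p−1} − q^{mp(p−1)/2}(q;q)_{p−1}) / ((1−q^{(m+1)p})(1−q^{mp})) is congruent to (p^2−1)p/24 modulo [p]_q. -/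
open Polynomial Finset

lemma prod_range_neg_inv_pow {K : Type*} [Field K] (q : K) (r : ℕ) :
    ∏ j ∈ range (2 * r), (-(q ^ (j + 1))⁻¹) = ((q ^ (2 * r + 1))⁻¹) ^ r := by
  induction r with
  | zero => simp
  | succ r ih =>
    rw [show 2 * (r + 1) = 2 * r + 1 + 1 by ring, prod_range_succ, prod_range_succ, ih]
    simp only [← inv_pow]
    ring

/-- Evaluating the shifted factorial at `q⁻ⁿ` reverses its factors. -/
lemma prod_one_sub_pow_mul_inv {K : Type*} [Field K] {q : K} (hq : q ≠ 0) (r : ℕ) :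
    ∏ j ∈ range (2 * r), (1 - q ^ (j + 1) * (q ^ (2 * r + 1))⁻¹) =
      ((q ^ (2 * r + 1))⁻¹) ^ r * ∏ j ∈ range (2 * r), (1 - q ^ (j + 1)) := by
  rw [← prod_range_neg_inv_pow, ← prod_mul_distrib, ← prod_range_reflect]
  refine prod_congr rfl fun j hj => ?_
  have hj := mem_range.mp hj
  have h : q ^ (2 * r + 1) = q ^ (2 * r - 1 - j + 1) * q ^ (j + 1) := by
    rw [← pow_add]; congr 1; omega
  rw [h]
  field_simp
  ring

lemma one_sub_X_mul_dvd {R : Type*} [CommRing R] [IsDomain R] [UniqueFactorizationMonoid R]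
    {a : R} (ha : a ≠ 0) (ha1 : a ≠ 1) {P : R[X]} (h1 : P.eval 1 = 0)
    (h2 : (P.map (algebraMap R (FractionRing R))).eval (algebraMap R (FractionRing R) a)⁻¹ = 0) :
    (1 - X) * (1 - C a * X) ∣ P := by
  classical
  let _ : NormalizedGCDMonoid R := Classical.choice inferInstance
  obtain ⟨G, rfl⟩ : 1 - X ∣ P := by
    rw [← neg_dvd, neg_sub, ← C_1, dvd_iff_isRoot]
    exact h1
  refine mul_dvd_mul_left _ ?_
  have hb : algebraMap R (FractionRing R) a ≠ 0 := by simpa using ha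
  have hb1 : algebraMap R (FractionRing R) a ≠ 1 := by simpa using ha1
  have hprim : (1 - C a * X : R[X]).IsPrimitive := fun s hs => by
    obtain ⟨t, ht⟩ := hs
    have := congrArg (eval 0) ht
    simp only [eval_sub, eval_one, eval_mul, eval_C, eval_X, mul_zero, sub_zero] at this
    exact IsUnit.of_mul_eq_one _ this.symm
  refine hprim.dvd_of_fraction_map_dvd_fraction_map (K := FractionRing R) ?_
  have hroot : (G.map (algebraMap R (FractionRing R))).eval
      (algebraMap R (FractionRing R) a)⁻¹ = 0 := by
    rw [Polynomial.map_mul, eval_mul] at h2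
    refine (mul_eq_zero.mp h2).resolve_left ?_
    simpa [sub_eq_zero, eq_comm (a := (1 : FractionRing R))] using hb1
  have hfac : (1 - C a * X : R[X]).map (algebraMap R (FractionRing R)) =
      C (-algebraMap R (FractionRing R) a) * (X - C (algebraMap R (FractionRing R) a)⁻¹) := by
    rw [mul_sub, ← C_mul, neg_mul, mul_inv_cancel₀ hb]
    simp
    ring
  rw [hfac, (isUnit_C.mpr (neg_ne_zero.mpr hb).isUnit).mul_left_dvd, dvd_iff_isRoot]
  exact hroot

/-- The polynomial in an auxiliary variable `X` whose value at `q ^ (m * n)`, for `n = 2 * r + 1`,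
is the difference of shifted factorials in Andrews' congruence. -/
noncomputable def shiftedFactorialDiff {R : Type*} [CommRing R] (q : R) (r : ℕ) : R[X] :=
  ∏ j ∈ range (2 * r), (1 - C (q ^ (j + 1)) * X) -
    X ^ r * C (∏ j ∈ range (2 * r), (1 - q ^ (j + 1)))

lemma map_shiftedFactorialDiff {R S : Type*} [CommRing R] [CommRing S] (φ : R →+* S) (q : R)
    (r : ℕ) : (shiftedFactorialDiff q r).map φ = shiftedFactorialDiff (φ q) r := by
  simp [shiftedFactorialDiff, Polynomial.map_prod]

lemma dvd_shiftedFactorialDiff (r : ℕ) :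
    (1 - X) * (1 - C ((X : ℤ[X]) ^ (2 * r + 1)) * X) ∣ shiftedFactorialDiff (X : ℤ[X]) r := by
  refine one_sub_X_mul_dvd (pow_ne_zero _ X_ne_zero) (fun h => ?_) ?_ ?_
  · simpa using congrArg (eval 0) h
  · simp [shiftedFactorialDiff, eval_prod]
  · have hX : algebraMap ℤ[X] (FractionRing ℤ[X]) X ≠ 0 := by simp
    rw [map_shiftedFactorialDiff, map_pow]
    simp only [shiftedFactorialDiff, eval_sub, eval_prod, eval_mul, eval_one, eval_C, eval_X,
      eval_pow]
    rw [prod_one_sub_pow_mul_inv hX, sub_self]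

lemma IsPrimitiveRoot.prod_one_sub_pow_mul_X {R : Type*} [CommRing R] [IsDomain R] {ζ : R}
    {n : ℕ} (h : IsPrimitiveRoot ζ (n + 1)) :
    ∏ j ∈ range n, (1 - C (ζ ^ (j + 1)) * X) = ∑ j ∈ range (n + 1), (X : R[X]) ^ j := by
  have hC := h.map_of_injective (C_injective (R := R))
  have key := congrArg (eval 1) (X_pow_sub_C_eq_prod hC n.succ_pos (rfl : (X : R[X]) ^ (n + 1) = _))
  simp only [eval_sub, eval_pow, eval_X, eval_C, one_pow, prod_range_succ', pow_zero,
    one_mul, eval_mul, eval_prod] at key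
  refine mul_right_cancel₀ (b := 1 - X) (fun h0 => ?_) ?_
  · simpa using congrArg (eval 0) h0
  · rw [geom_sum_mul_neg, key]
    simp

lemma sum_range_mul_sub_one (n : ℕ) :
    3 * ∑ j ∈ range n, (j : ℂ) * (j - 1) = n * (n - 1) * (n - 2) := by
  induction n with
  | zero => simp
  | succ n ih => rw [sum_range_succ, mul_add, ih]; push_cast; ring

lemma eval_one_derivative_derivative_X_pow (n : ℕ) :
    (derivative (derivative ((X : ℂ[X]) ^ n))).eval 1 = n * (n - 1) := by
  rcases n with _ | n <;> simp [derivative_X_pow]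

/-- At a primitive root of unity, the quotient is evaluated by taking second derivatives. -/
lemma eval_one_of_shiftedFactorialDiff_eq {ζ : ℂ} {r : ℕ} (h : IsPrimitiveRoot ζ (2 * r + 1))
    {F : ℂ[X]} (hF : shiftedFactorialDiff ζ r = (1 - X) ^ 2 * F) :
    6 * F.eval 1 = r * (r + 1) * (2 * r + 1) := by
  have key := congrArg (fun P => (derivative (derivative P)).eval 1) hF
  rw [shiftedFactorialDiff, h.prod_one_sub_pow_mul_X, h.prod_one_sub_pow_eq_order] at key
  simp only [derivative_sub, derivative_sum, derivative_mul, derivative_C, mul_zero, add_zero,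
    eval_sub, eval_finsetSum, eval_mul, eval_C, eval_one_derivative_derivative_X_pow] at key
  have hs := sum_range_mul_sub_one (2 * r + 1)
  simp [derivative_pow] at key
  push_cast at hs
  linear_combination (-3) * key + hs

lemma map_eval_of_shiftedFactorialDiff_eq {ζ : ℂ} {r : ℕ} (h : IsPrimitiveRoot ζ (2 * r + 1))
    {F : ℤ[X][X]} (hF : shiftedFactorialDiff (X : ℤ[X]) r =
      (1 - X) * (1 - C ((X : ℤ[X]) ^ (2 * r + 1)) * X) * F)
    (φ : ℤ[X] →+* ℂ) (hφ : φ X = ζ) (m : ℕ) :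
    6 * φ (F.eval (X ^ (m * (2 * r + 1)))) = r * (r + 1) * (2 * r + 1) := by
  have key := congrArg (Polynomial.map φ) hF
  rw [map_shiftedFactorialDiff, hφ, Polynomial.map_mul, Polynomial.map_mul, Polynomial.map_sub,
    Polynomial.map_sub, Polynomial.map_mul, Polynomial.map_one, map_X, map_C, map_pow, hφ,
    h.pow_eq_one, C_1, one_mul, ← sq] at key
  rw [← eval_map_apply, map_pow, hφ, mul_comm m, pow_mul, h.pow_eq_one, one_pow]
  exact eval_one_of_shiftedFactorialDiff_eq h key

lemma six_dvd_mul_succ_mul (r : ℕ) : (6 : ℤ) ∣ r * (r + 1) * (2 * r + 1) := by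
  induction r with
  | zero => simp
  | succ r ih =>
    have : ((r + 1 : ℕ) : ℤ) * ((r + 1 : ℕ) + 1) * (2 * (r + 1 : ℕ) + 1) =
        r * (r + 1) * (2 * r + 1) + 6 * (r + 1) ^ 2 := by push_cast; ring
    rw [this]
    exact dvd_add ih (dvd_mul_right _ _)

theorem andrews_q_glaisher (p : ℕ) (hp : p.Prime) (hodd : Odd p) (m : ℕ) (hm : 1 ≤ m) :
    ∃ f : Polynomial ℤ,
      (∏ i ∈ Finset.Ico 1 p, (1 - X ^ (m * p + i))) -
          X ^ (m * p * (p - 1) / 2) * ∏ i ∈ Finset.Ico 1 p, (1 - X ^ i) =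
        (1 - X ^ ((m + 1) * p)) * (1 - X ^ (m * p)) * f ∧
      qInt p ∣ f - C ((((p : ℤ) ^ 2 - 1) * p) / 24) := by
  obtain ⟨r, rfl⟩ := hodd
  obtain ⟨F, hF⟩ := dvd_shiftedFactorialDiff r
  refine ⟨F.eval (X ^ (m * (2 * r + 1))), ?_, ?_⟩
  · have key := congrArg (eval (X ^ (m * (2 * r + 1)))) hF
    have he : m * (2 * r + 1) * (2 * r + 1 - 1) / 2 = m * (2 * r + 1) * r := by
      rw [Nat.add_sub_cancel, show m * (2 * r + 1) * (2 * r) = 2 * (m * (2 * r + 1) * r) by ring,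
        Nat.mul_div_cancel_left _ two_pos]
    simp only [shiftedFactorialDiff, eval_sub, eval_prod, eval_mul, eval_one, eval_C, eval_X,
      eval_pow] at key
    rw [he, prod_Ico_eq_prod_range, prod_Ico_eq_prod_range, Nat.add_sub_cancel]
    convert key using 2
    · exact prod_congr rfl fun j _ => by ring
    · rw [pow_mul]
      congr 1
      exact prod_congr rfl fun j _ => by ring
    · ring
  · have : Fact (2 * r + 1).Prime := ⟨hp⟩
    have hζ := Complex.isPrimitiveRoot_exp (2 * r + 1) (by omega)
    generalize Complex.exp _ = ζ at hζ
    rw [qInt, ← cyclotomic_prime ℤ (2 * r + 1), cyclotomic_eq_minpoly hζ hp.pos]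
    refine minpoly.isIntegrallyClosed_dvd (hζ.isIntegral hp.pos) ?_
    obtain ⟨c, hc⟩ := six_dvd_mul_succ_mul r
    have hc' : (((2 * r + 1 : ℕ) : ℤ) ^ 2 - 1) * (2 * r + 1 : ℕ) = 24 * c := by
      push_cast
      linear_combination 4 * hc
    have hev : 6 * aeval ζ (F.eval (X ^ (m * (2 * r + 1)))) = _ :=
      map_eval_of_shiftedFactorialDiff_eq hζ hF (aeval ζ).toRingHom (aeval_X ζ) m
    have hcC : (r : ℂ) * (r + 1) * (2 * r + 1) = 6 * c := by exact_mod_cast hc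
    rw [hcC] at hev
    rw [map_sub, hc', Int.mul_ediv_cancel_left _ (by norm_num)]
    simpa [sub_eq_zero] using hev
end
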